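/- arXiv:1010.2050 — 2 statements merged into one kernel-verified Lean document; each statement's English description precedes it below -/
import Mathlib

section
/- Let H be a complex Hilbert space with dim H ≥ 3 and let A = B(H) be the C*-algebra of bounded operators on H. Then the projection π : Σ → 𝒞(A) admits no continuous cross-section (topological Kochen–Specker theorem). -/
open WeakDual WeakDual.CharacterSpace

variable (A : Type*) [NormedRing A] [StarRing A] [CStarRing A] [NormedAlgebra ℂ A]
  [StarModule ℂ A] [CompleteSpace A]

/-- `𝒞(A)`: the poset of commutative unital C*-subalgebras of `A`, i.e. closed, ⋆-closed
commutative subalgebras containing the unit, ordered by inclusion. -/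
abbrev CommCStarSubalg :=
  {C : StarSubalgebra ℂ A // IsClosed (C : Set A) ∧ ∀ x ∈ C, ∀ y ∈ C, x * y = y * x}

/-- `Σ = ∐_{C ∈ 𝒞(A)} Σ(C)`: the disjoint union of the Gelfand spectra (character spaces,
with the relative weak-* topology) of the commutative unital C*-subalgebras of `A`. -/
abbrev GelfandSpec := (C : CommCStarSubalg A) × characterSpace ℂ C.1

variable {A}

/-- `RestrictsTo h ψ φ` says that `ψ ∈ Σ(D)` restricts to `φ ∈ Σ(C)` along `C ⊆ D`,
i.e. `ψ|_C = φ`. -/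
def RestrictsTo {C D : CommCStarSubalg A} (h : C ≤ D) (ψ : characterSpace ℂ D.1)
    (φ : characterSpace ℂ C.1) : Prop :=
  ∀ a : C.1, ψ ⟨a.1, h a.2⟩ = φ a

variable (A)

/-- Conditions (1) and (2) on a subset `𝒰 ⊆ Σ`:
(1) each `𝒰_C = 𝒰 ∩ Σ(C)` is open in `Σ(C)`, and
(2) if `C ⊆ D`, `λ ∈ 𝒰_C` and `λ' ∈ Σ(D)` restricts to `λ`, then `λ' ∈ 𝒰_D`. -/
def IsGoodOpen (U : Set (GelfandSpec A)) : Prop :=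
  (∀ C : CommCStarSubalg A,
    IsOpen {φ : characterSpace ℂ C.1 | (⟨C, φ⟩ : GelfandSpec A) ∈ U}) ∧
  (∀ (C D : CommCStarSubalg A) (h : C ≤ D) (φ : characterSpace ℂ C.1)
    (ψ : characterSpace ℂ D.1), RestrictsTo h ψ φ →
      (⟨C, φ⟩ : GelfandSpec A) ∈ U → (⟨D, ψ⟩ : GelfandSpec A) ∈ U)

/-- The topology on `Σ` whose open sets are those satisfying conditions (1) and (2). -/
instance (priority := 2000) gelfandSpecTopology : TopologicalSpace (GelfandSpec A) where
  IsOpen := IsGoodOpen A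
  isOpen_univ := ⟨fun _ => isOpen_univ, fun _ _ _ _ _ _ _ => trivial⟩
  isOpen_inter := fun U V hU hV =>
    ⟨fun C => (hU.1 C).inter (hV.1 C),
     fun C D h φ ψ hr hm => ⟨hU.2 C D h φ ψ hr hm.1, hV.2 C D h φ ψ hr hm.2⟩⟩
  isOpen_sUnion := fun S hS =>
    ⟨fun C => by
      have : {φ : characterSpace ℂ C.1 | (⟨C, φ⟩ : GelfandSpec A) ∈ ⋃₀ S}
          = ⋃ U ∈ S, {φ : characterSpace ℂ C.1 | (⟨C, φ⟩ : GelfandSpec A) ∈ U} := by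
        ext φ; simp
      rw [this]
      exact isOpen_biUnion fun U hU => (hS U hU).1 C,
     fun C D h φ ψ hr hm => by
      obtain ⟨U, hU, hm⟩ := hm
      exact ⟨U, hU, (hS U hU).2 C D h φ ψ hr hm⟩⟩

/-- The Alexandrov topology on `𝒞(A)`: open sets are exactly the upward closed sets. -/
instance (priority := 2000) commCStarSubalgTopology :
    TopologicalSpace (CommCStarSubalg A) where
  IsOpen U := ∀ ⦃C D : CommCStarSubalg A⦄, C ≤ D → C ∈ U → D ∈ U
  isOpen_univ := fun _ _ _ _ => trivial
  isOpen_inter := fun U V hU hV C D h hm => ⟨hU h hm.1, hV h hm.2⟩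
  isOpen_sUnion := fun S hS C D h hm => by
    obtain ⟨U, hU, hm⟩ := hm
    exact ⟨U, hU, hS U hU h hm⟩

lemma ks_core (f : ℤ → ℤ → ℤ → Prop)
    (h2 : ∀ {a b c a' b' c' : ℤ}, a * a' + b * b' + c * c' = 0 → f a b c → ¬ f a' b' c')
    (h3 : ∀ {a b c a' b' c' a2 b2 c2 : ℤ}, a * a' + b * b' + c * c' = 0 →
      a * a2 + b * b2 + c * c2 = 0 → a' * a2 + b' * b2 + c' * c2 = 0 →
      a * a + b * b + c * c ≠ 0 → a' * a' + b' * b' + c' * c' ≠ 0 →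
      a2 * a2 + b2 * b2 + c2 * c2 ≠ 0 → ¬ f a b c → ¬ f a' b' c' → f a2 b2 c2)
    (t0 : f 0 0 1) : False := by
  by_cases t1 : f 0 1 (-1)
  · have k3 : ¬ f 0 1 0 := h2 (by norm_num) t0
    have k15 : ¬ f 1 (-1) 0 := h2 (by norm_num) t0
    have k25 : ¬ f 1 1 0 := h2 (by norm_num) t0
    have k4 : ¬ f 0 1 1 := h2 (by norm_num) t1
    have k14 : ¬ f 1 (-1) (-1) := h2 (by norm_num) t1
    have k26 : ¬ f 1 1 1 := h2 (by norm_num) t1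
    have k17 : f 1 (-1) 2 := h3 (by norm_num) (by norm_num) (by norm_num) (by norm_num) (by norm_num) (by norm_num) k14 k25
    have k40 : ¬ f 2 0 (-1) := h2 (by norm_num) k17
    have k22 : f 1 0 2 := h3 (by norm_num) (by norm_num) (by norm_num) (by norm_num) (by norm_num) (by norm_num) k3 k40
    have k43 : ¬ f 2 1 (-1) := h2 (by norm_num) k22
    have k16 : f 1 (-1) 1 := h3 (by norm_num) (by norm_num) (by norm_num) (by norm_num) (by norm_num) (by norm_num) k4 k43
    have k19 : ¬ f 1 0 (-1) := h2 (by norm_num) k16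
    have k21 : f 1 0 1 := h3 (by norm_num) (by norm_num) (by norm_num) (by norm_num) (by norm_num) (by norm_num) k3 k19
    have k24 : ¬ f 1 1 (-1) := h2 (by norm_num) k21
    have k38 : f 2 (-1) 1 := h3 (by norm_num) (by norm_num) (by norm_num) (by norm_num) (by norm_num) (by norm_num) k4 k24
    have k18 : ¬ f 1 0 (-2) := h2 (by norm_num) k38
    have k41 : f 2 0 1 := h3 (by norm_num) (by norm_num) (by norm_num) (by norm_num) (by norm_num) (by norm_num) k3 k18
    have k23 : ¬ f 1 1 (-2) := h2 (by norm_num) k41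
    exact k26 (h3 (by norm_num) (by norm_num) (by norm_num) (by norm_num) (by norm_num) (by norm_num) k15 k23)
  · have k3 : ¬ f 0 1 0 := h2 (by norm_num) t0
    have k15 : ¬ f 1 (-1) 0 := h2 (by norm_num) t0
    have k20 : ¬ f 1 0 0 := h2 (by norm_num) t0
    have k25 : ¬ f 1 1 0 := h2 (by norm_num) t0
    have k4 : f 0 1 1 := h3 (by norm_num) (by norm_num) (by norm_num) (by norm_num) (by norm_num) (by norm_num) t1 k20
    have k16 : ¬ f 1 (-1) 1 := h2 (by norm_num) k4
    have k24 : ¬ f 1 1 (-1) := h2 (by norm_num) k4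
    have k13 : f 1 (-1) (-2) := h3 (by norm_num) (by norm_num) (by norm_num) (by norm_num) (by norm_num) (by norm_num) k16 k25
    have k41 : ¬ f 2 0 1 := h2 (by norm_num) k13
    have k18 : f 1 0 (-2) := h3 (by norm_num) (by norm_num) (by norm_num) (by norm_num) (by norm_num) (by norm_num) k3 k41
    have k45 : ¬ f 2 1 1 := h2 (by norm_num) k18
    have k14 : f 1 (-1) (-1) := h3 (by norm_num) (by norm_num) (by norm_num) (by norm_num) (by norm_num) (by norm_num) t1 k45
    have k21 : ¬ f 1 0 1 := h2 (by norm_num) k14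
    have k19 : f 1 0 (-1) := h3 (by norm_num) (by norm_num) (by norm_num) (by norm_num) (by norm_num) (by norm_num) k3 k21
    have k26 : ¬ f 1 1 1 := h2 (by norm_num) k19
    have k9 : f 1 (-2) (-1) := h3 (by norm_num) (by norm_num) (by norm_num) (by norm_num) (by norm_num) (by norm_num) k21 k24
    have k1 : ¬ f 0 1 (-2) := h2 (by norm_num) k9
    have k7 : f 0 2 1 := h3 (by norm_num) (by norm_num) (by norm_num) (by norm_num) (by norm_num) (by norm_num) k1 k20
    have k23 : ¬ f 1 1 (-2) := h2 (by norm_num) k7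
    exact k26 (h3 (by norm_num) (by norm_num) (by norm_num) (by norm_num) (by norm_num) (by norm_num) k15 k23)

lemma ks_int (f : ℤ → ℤ → ℤ → Prop)
    (h2 : ∀ {a b c a' b' c' : ℤ}, a * a' + b * b' + c * c' = 0 → f a b c → ¬ f a' b' c')
    (h3 : ∀ {a b c a' b' c' a2 b2 c2 : ℤ}, a * a' + b * b' + c * c' = 0 →
      a * a2 + b * b2 + c * c2 = 0 → a' * a2 + b' * b2 + c' * c2 = 0 →
      a * a + b * b + c * c ≠ 0 → a' * a' + b' * b' + c' * c' ≠ 0 →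
      a2 * a2 + b2 * b2 + c2 * c2 ≠ 0 → ¬ f a b c → ¬ f a' b' c' → f a2 b2 c2) : False := by
  by_cases t0 : f 0 0 1
  · exact ks_core f h2 h3 t0
  by_cases t1 : f 0 1 0
  · refine ks_core (fun a b c => f b c a) (fun h => h2 (by linarith))
      (fun p q r s t u => h3 (by linarith) (by linarith) (by linarith) ?_ ?_ ?_) t1
    · intro h; exact s (by linarith)
    · intro h; exact t (by linarith)
    · intro h; exact u (by linarith)
  have t2 : f 1 0 0 := h3 (by norm_num) (by norm_num) (by norm_num) (by norm_num) (by norm_num)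
    (by norm_num) t0 t1
  refine ks_core (fun a b c => f c a b) (fun h => h2 (by linarith))
      (fun p q r s t u => h3 (by linarith) (by linarith) (by linarith) ?_ ?_ ?_) t2
  · intro h; exact s (by linarith)
  · intro h; exact t (by linarith)
  · intro h; exact u (by linarith)

section KSaux

lemma exists_compatible {σ : CommCStarSubalg A → GelfandSpec A} (hc : Continuous σ)
    (hσ : ∀ C, (σ C).1 = C) :
    ∃ χ : ∀ C : CommCStarSubalg A, characterSpace ℂ C.1,
      ∀ (C D : CommCStarSubalg A) (h : C ≤ D) (a : A) (ha : a ∈ C.1),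
        χ D ⟨a, h ha⟩ = χ C ⟨a, ha⟩ := by
  have h1 : ∀ C, ∃ χ : characterSpace ℂ C.1, σ C = ⟨C, χ⟩ := by
    intro C
    have := hσ C
    generalize σ C = p at this
    obtain ⟨D, ψ⟩ := p
    subst this
    exact ⟨ψ, rfl⟩
  choose χ hχ using h1
  refine ⟨χ, fun C D h a ha => ?_⟩
  by_contra hne
  let U : Set (GelfandSpec A) :=
    {p | ∃ hp : C ≤ p.1, p.2 ⟨a, hp ha⟩ ≠ χ D ⟨a, h ha⟩}
  have hU : IsGoodOpen A U := by
    constructor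
    · intro E
      by_cases hE : C ≤ E
      · have : {φ : characterSpace ℂ E.1 | (⟨E, φ⟩ : GelfandSpec A) ∈ U} =
            {φ : characterSpace ℂ E.1 | φ ⟨a, hE ha⟩ ≠ χ D ⟨a, h ha⟩} := by
          ext φ
          exact ⟨fun ⟨_, h⟩ => h, fun h => ⟨hE, h⟩⟩
        rw [this]
        have hcont : Continuous (fun φ : characterSpace ℂ E.1 => φ ⟨a, hE ha⟩) :=
          (WeakDual.eval_continuous (𝕜 := ℂ) (E := E.1) ⟨a, hE ha⟩).comp continuous_subtype_val
        exact isOpen_ne.preimage hcont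
      · have : {φ : characterSpace ℂ E.1 | (⟨E, φ⟩ : GelfandSpec A) ∈ U} = ∅ := by
          ext φ
          exact ⟨fun ⟨h, _⟩ => (hE h).elim, fun h => h.elim⟩
        rw [this]
        exact isOpen_empty
    · rintro E F hEF φ ψ hr ⟨hE, hm⟩
      refine ⟨hE.trans hEF, ?_⟩
      have := hr ⟨a, hE ha⟩
      exact fun h => hm (this.symm.trans h)
  have hU' : IsOpen U := hU
  have hpre : IsOpen (σ ⁻¹' U) := hU'.preimage hc
  have hC : C ∈ σ ⁻¹' U := by
    show σ C ∈ U
    rw [hχ C]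
    exact ⟨le_rfl, fun h => hne h.symm⟩
  have hD : D ∈ σ ⁻¹' U := hpre h hC
  change σ D ∈ U at hD
  rw [hχ D] at hD
  obtain ⟨_, hD⟩ := hD
  exact hD rfl

variable {A}

/-- The bicommutant of a commuting set of selfadjoint elements. -/
def bicomm (S : Set A) (hs : ∀ x ∈ S, IsSelfAdjoint x)
    (hcm : ∀ x ∈ S, ∀ y ∈ S, x * y = y * x) : CommCStarSubalg A :=
  ⟨StarSubalgebra.centralizer ℂ (StarSubalgebra.centralizer ℂ S : Set A), by
    constructor
    · rw [StarSubalgebra.coe_centralizer]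
      exact Set.isClosed_centralizer _
    · have hS : S ∪ star S = S := by
        apply Set.union_eq_left.2
        intro x hx
        have := hs _ (Set.mem_star.1 hx)
        rw [isSelfAdjoint_iff, star_star] at this
        rw [this]
        exact Set.mem_star.1 hx
      intro x hx y hy
      rw [← SetLike.mem_coe, StarSubalgebra.coe_centralizer_centralizer, hS] at hx hy
      exact Set.centralizer_centralizer_comm_of_comm hcm _ hx _ hy⟩

lemma mem_bicomm {S : Set A} {hs hcm} {a : A} (ha : a ∈ S) : a ∈ (bicomm S hs hcm).1 := by
  show a ∈ StarSubalgebra.centralizer ℂ (StarSubalgebra.centralizer ℂ S : Set A)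
  rw [StarSubalgebra.mem_centralizer_iff]
  intro g hg
  have h1 : star g ∈ StarSubalgebra.centralizer ℂ S := star_mem hg
  have h2 : g ∈ StarSubalgebra.centralizer ℂ S := hg
  rw [StarSubalgebra.mem_centralizer_iff] at h1 h2
  exact ⟨(h2 a ha).1.symm, (h1 a ha).1.symm⟩

lemma bicomm_le {S T : Set A} {hs hcm hs' hcm'} (h : ∀ a ∈ S, a ∈ (bicomm T hs' hcm').1) :
    bicomm S hs hcm ≤ bicomm T hs' hcm' := by
  show StarSubalgebra.centralizer ℂ (StarSubalgebra.centralizer ℂ S : Set A) ≤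
    StarSubalgebra.centralizer ℂ (StarSubalgebra.centralizer ℂ T : Set A)
  apply StarSubalgebra.centralizer_le
  intro g hg
  rw [SetLike.mem_coe, StarSubalgebra.mem_centralizer_iff]
  intro a ha
  have h1 := h a ha
  change a ∈ StarSubalgebra.centralizer ℂ (StarSubalgebra.centralizer ℂ T : Set A) at h1
  have h2 := star_mem h1
  rw [StarSubalgebra.mem_centralizer_iff] at h1 h2
  exact ⟨(h1 g hg).1.symm, (h2 g hg).1.symm⟩

/-- A (quasi-)valuation. -/
structure IsVal (v : A → ℂ) : Prop where
  one : v 1 = 1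
  add : ∀ a b, IsSelfAdjoint a → IsSelfAdjoint b → a * b = b * a → v (a + b) = v a + v b
  mul : ∀ a b, IsSelfAdjoint a → IsSelfAdjoint b → a * b = b * a → v (a * b) = v a * v b

lemma exists_val {σ : CommCStarSubalg A → GelfandSpec A} (hc : Continuous σ)
    (hσ : ∀ C, (σ C).1 = C) : ∃ v : A → ℂ, IsVal v := by
  classical
  obtain ⟨χ, hχ⟩ := exists_compatible A hc hσ
  have hs1 : ∀ {a : A}, IsSelfAdjoint a → ∀ x ∈ ({a} : Set A), IsSelfAdjoint x := by
    rintro a ha x rfl; exact ha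
  have hc1 : ∀ {a : A}, ∀ x ∈ ({a} : Set A), ∀ y ∈ ({a} : Set A), x * y = y * x := by
    rintro a x rfl y rfl; rfl
  let v : A → ℂ := fun a => if h : IsSelfAdjoint a then
    χ (bicomm {a} (hs1 h) hc1) ⟨a, mem_bicomm rfl⟩ else 0
  have key : ∀ (S : Set A) (hs) (hcm) (a : A) (_ : IsSelfAdjoint a)
      (ha : a ∈ (bicomm S hs hcm).1), v a = χ (bicomm S hs hcm) ⟨a, ha⟩ := by
    intro S hs hcm a hsa ha
    simp only [v, dif_pos hsa]
    refine (hχ (bicomm {a} (hs1 hsa) hc1) (bicomm S hs hcm) (bicomm_le ?_) a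
      (mem_bicomm (Set.mem_singleton a))).symm
    rintro x rfl
    exact ha
  have pair : ∀ a b : A, IsSelfAdjoint a → IsSelfAdjoint b → a * b = b * a →
      v (a + b) = v a + v b ∧ v (a * b) = v a * v b := by
    intro a b ha hb hab
    have hs : ∀ x ∈ ({a, b} : Set A), IsSelfAdjoint x := by
      rintro x (rfl | rfl) <;> assumption
    have hcm : ∀ x ∈ ({a, b} : Set A), ∀ y ∈ ({a, b} : Set A), x * y = y * x := by
      rintro x (rfl | rfl) y (rfl | rfl)
      · rfl
      · exact hab
      · exact hab.symm
      · rfl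
    have ma : a ∈ (bicomm {a, b} hs hcm).1 := mem_bicomm (by simp)
    have mb : b ∈ (bicomm {a, b} hs hcm).1 := mem_bicomm (by simp)
    have hm : IsSelfAdjoint (a * b) := (ha.commute_iff hb).1 hab
    rw [key _ hs hcm a ha ma, key _ hs hcm b hb mb, key _ hs hcm (a + b) (ha.add hb) (add_mem ma mb),
      key _ hs hcm (a * b) hm (mul_mem ma mb)]
    exact ⟨map_add (χ (bicomm {a, b} hs hcm)) ⟨a, ma⟩ ⟨b, mb⟩,
      map_mul (χ (bicomm {a, b} hs hcm)) ⟨a, ma⟩ ⟨b, mb⟩⟩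
  refine ⟨v, ?_, fun a b ha hb h => (pair a b ha hb h).1, fun a b ha hb h => (pair a b ha hb h).2⟩
  rw [key _ (hs1 (IsSelfAdjoint.one A)) hc1 1 (.one A) (one_mem _)]
  exact map_one (χ (bicomm {1} _ _))

namespace IsVal

variable {v : A → ℂ}

lemma zero (hv : IsVal v) : v 0 = 0 := by
  have := hv.add 0 0 (.zero A) (.zero A) rfl
  simpa using this

lemma sum (hv : IsVal v) {ι : Type*} (s : Finset ι) (q : ι → A) (hq : ∀ i, IsSelfAdjoint (q i))
    (hqc : ∀ i j, q i * q j = q j * q i) : v (∑ i ∈ s, q i) = ∑ i ∈ s, v (q i) := by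
  classical
  induction s using Finset.induction_on with
  | empty => simpa using hv.zero
  | insert a s ha ih =>
    rw [Finset.sum_insert ha, Finset.sum_insert ha, hv.add, ih]
    · exact hq a
    · exact isSelfAdjoint_sum s (fun i _ => hq i)
    · rw [Finset.mul_sum, Finset.sum_mul]
      exact Finset.sum_congr rfl fun i _ => hqc _ _

lemma zero_or_one (hv : IsVal v) {p : A} (hp : IsSelfAdjoint p) (hpp : p * p = p) : v p = 0 ∨ v p = 1 := by
  have h := hv.mul p p hp hp rfl
  rw [hpp] at h
  have : v p * (v p - 1) = 0 := by linear_combination -h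
  rcases mul_eq_zero.1 this with h | h
  · exact Or.inl h
  · exact Or.inr (sub_eq_zero.1 h)

lemma orth (hv : IsVal v) {p q : A} (hp : IsSelfAdjoint p) (hq : IsSelfAdjoint q) (hpq : p * q = 0)
    (hqp : q * p = 0) : v p * v q = 0 := by
  rw [← hv.mul p q hp hq (hpq.trans hqp.symm), hpq, hv.zero]

end IsVal

/-- Orthogonal triple of nonzero integer vectors: resolution of the identity. -/
lemma triple_res {a b c a' b' c' a2 b2 c2 : ℂ} (h12 : a * a' + b * b' + c * c' = 0)
    (h13 : a * a2 + b * b2 + c * c2 = 0) (h23 : a' * a2 + b' * b2 + c' * c2 = 0)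
    {n n' n2 : ℂ} (e1 : n = a * a + b * b + c * c) (e2 : n' = a' * a' + b' * b' + c' * c')
    (e3 : n2 = a2 * a2 + b2 * b2 + c2 * c2) (h1 : n ≠ 0) (h2 : n' ≠ 0) (h3 : n2 ≠ 0) :
    n⁻¹ * (a * a) + n'⁻¹ * (a' * a') + n2⁻¹ * (a2 * a2) = 1 ∧
    n⁻¹ * (a * b) + n'⁻¹ * (a' * b') + n2⁻¹ * (a2 * b2) = 0 ∧
    n⁻¹ * (a * c) + n'⁻¹ * (a' * c') + n2⁻¹ * (a2 * c2) = 0 ∧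
    n⁻¹ * (b * b) + n'⁻¹ * (b' * b') + n2⁻¹ * (b2 * b2) = 1 ∧
    n⁻¹ * (b * c) + n'⁻¹ * (b' * c') + n2⁻¹ * (b2 * c2) = 0 ∧
    n⁻¹ * (c * c) + n'⁻¹ * (c' * c') + n2⁻¹ * (c2 * c2) = 1 := by
  have hM : !![n⁻¹ * a, n⁻¹ * b, n⁻¹ * c; n'⁻¹ * a', n'⁻¹ * b', n'⁻¹ * c';
      n2⁻¹ * a2, n2⁻¹ * b2, n2⁻¹ * c2] * !![a, a', a2; b, b', b2; c, c', c2] = 1 := by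
    ext i j
    fin_cases i <;> fin_cases j <;> simp [Matrix.mul_apply, Fin.sum_univ_three]
    · field_simp; linear_combination -e1
    · linear_combination n⁻¹ * h12
    · linear_combination n⁻¹ * h13
    · linear_combination n'⁻¹ * h12
    · field_simp; linear_combination -e2
    · linear_combination n'⁻¹ * h23
    · linear_combination n2⁻¹ * h13
    · linear_combination n2⁻¹ * h23
    · field_simp; linear_combination -e3
  have hM' := mul_eq_one_comm.1 hM
  have H : ∀ i j, _ := fun i j => congrFun (congrFun hM' i) j
  have h00 := H 0 0
  have h01 := H 0 1
  have h02 := H 0 2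
  have h11 := H 1 1
  have h12' := H 1 2
  have h22 := H 2 2
  simp [Matrix.mul_apply, Fin.sum_univ_three] at h00 h01 h02 h11 h12' h22
  refine ⟨?_, ?_, ?_, ?_, ?_, ?_⟩
  · linear_combination h00
  · linear_combination h01
  · linear_combination h02
  · linear_combination h11
  · linear_combination h12'
  · linear_combination h22

open ContinuousLinearMap in
lemma no_val_of_frame {K H : Type*} [NormedAddCommGroup H] [InnerProductSpace ℂ H]
    [CompleteSpace H] [NormedAddCommGroup K] [InnerProductSpace ℂ K] [CompleteSpace K]
    {v : (H →L[ℂ] H) → ℂ} (hv : IsVal v) (e : Fin 3 → (K →L[ℂ] H))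
    (he : ∀ i j, adjoint (e i) ∘L e j = if i = j then ContinuousLinearMap.id ℂ K else 0)
    (h1 : v (e 0 ∘L adjoint (e 0) + e 1 ∘L adjoint (e 1) + e 2 ∘L adjoint (e 2)) = 1) :
    False := by
  let w : ℤ → ℤ → ℤ → (K →L[ℂ] H) := fun a b c => (a : ℂ) • e 0 + (b : ℂ) • e 1 + (c : ℂ) • e 2
  have hw : ∀ a b c, adjoint (w a b c) =
      (a : ℂ) • adjoint (e 0) + (b : ℂ) • adjoint (e 1) + (c : ℂ) • adjoint (e 2) := by
    intro a b c
    simp [w, map_add, map_smulₛₗ]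
  have hww : ∀ a b c a' b' c', adjoint (w a b c) ∘L w a' b' c' =
      ((a * a' + b * b' + c * c' : ℤ) : ℂ) • ContinuousLinearMap.id ℂ K := by
    intro a b c a' b' c'
    rw [hw]
    simp only [w, comp_add, add_comp, smul_comp, comp_smul, he]
    simp
    module
  let P : ℤ → ℤ → ℤ → (H →L[ℂ] H) := fun a b c =>
    ((a * a + b * b + c * c : ℤ) : ℂ)⁻¹ • (w a b c ∘L adjoint (w a b c))
  have hPP : ∀ a b c a' b' c', P a b c * P a' b' c' =
      (((a * a + b * b + c * c : ℤ) : ℂ)⁻¹ * ((a' * a' + b' * b' + c' * c' : ℤ) : ℂ)⁻¹ *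
      ((a * a' + b * b' + c * c' : ℤ) : ℂ)) • (w a b c ∘L adjoint (w a' b' c')) := by
    intro a b c a' b' c'
    have : (w a b c ∘L adjoint (w a b c)) * (w a' b' c' ∘L adjoint (w a' b' c')) =
      w a b c ∘L (adjoint (w a b c) ∘L w a' b' c') ∘L adjoint (w a' b' c') := rfl
    simp only [P]
    rw [smul_mul_smul_comm, this, hww, smul_comp, comp_smul, smul_smul]
    rfl
  have hsa : ∀ a b c, IsSelfAdjoint (P a b c) := by
    intro a b c
    rw [isSelfAdjoint_iff]
    simp only [P, star_smul, star_eq_adjoint, adjoint_comp, adjoint_adjoint]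
    simp
  have horth : ∀ a b c a' b' c', a * a' + b * b' + c * c' = 0 → P a b c * P a' b' c' = 0 := by
    intro a b c a' b' c' h
    rw [hPP, h]
    simp
  have hidem : ∀ a b c, P a b c * P a b c = P a b c := by
    intro a b c
    rw [hPP]
    simp only [P]
    congr 1
    by_cases h : ((a * a + b * b + c * c : ℤ) : ℂ) = 0
    · rw [h]; simp
    · field_simp
  apply ks_int (fun a b c => v (P a b c) = 1)
  · intro a b c a' b' c' h h1 h2
    have := hv.orth (hsa a b c) (hsa a' b' c') (horth _ _ _ _ _ _ h)
      (horth _ _ _ _ _ _ (by linarith))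
    rw [h1, h2] at this
    norm_num at this
  · intro a b c a' b' c' a2 b2 c2 h12 h13 h23 k1 k2 k3 n1 n2
    have z1 := (hv.zero_or_one (hsa a b c) (hidem a b c)).resolve_right n1
    have z2 := (hv.zero_or_one (hsa a' b' c') (hidem a' b' c')).resolve_right n2
    have hsum : P a b c + P a' b' c' + P a2 b2 c2 =
        e 0 ∘L adjoint (e 0) + e 1 ∘L adjoint (e 1) + e 2 ∘L adjoint (e 2) := by
      obtain ⟨r1, r2, r3, r4, r5, r6⟩ := triple_res (a := a) (b := b) (c := c) (a' := a')
        (b' := b') (c' := c') (a2 := a2) (b2 := b2) (c2 := c2)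
        (n := ((a * a + b * b + c * c : ℤ) : ℂ)) (n' := ((a' * a' + b' * b' + c' * c' : ℤ) : ℂ))
        (n2 := ((a2 * a2 + b2 * b2 + c2 * c2 : ℤ) : ℂ)) (by exact_mod_cast h12)
        (by exact_mod_cast h13) (by exact_mod_cast h23) (by push_cast; ring) (by push_cast; ring)
        (by push_cast; ring) (by exact_mod_cast k1) (by exact_mod_cast k2) (by exact_mod_cast k3)
      simp only [P, hw]
      simp only [w, comp_add, add_comp, smul_comp, comp_smul]
      generalize ((a * a + b * b + c * c : ℤ) : ℂ)⁻¹ = m1 at *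
      generalize ((a' * a' + b' * b' + c' * c' : ℤ) : ℂ)⁻¹ = m2 at *
      generalize ((a2 * a2 + b2 * b2 + c2 * c2 : ℤ) : ℂ)⁻¹ = m3 at *
      linear_combination (norm := module) r1 • (e 0 ∘L adjoint (e 0)) + r4 • (e 1 ∘L adjoint (e 1)) +
        r6 • (e 2 ∘L adjoint (e 2)) + r2 • (e 0 ∘L adjoint (e 1)) + r2 • (e 1 ∘L adjoint (e 0)) +
        r3 • (e 0 ∘L adjoint (e 2)) + r3 • (e 2 ∘L adjoint (e 0)) +
        r5 • (e 1 ∘L adjoint (e 2)) + r5 • (e 2 ∘L adjoint (e 1))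
    have c12 : P a b c * P a' b' c' = P a' b' c' * P a b c := by
      rw [horth _ _ _ _ _ _ h12, horth _ _ _ _ _ _ (by linarith)]
    have c3 : (P a b c + P a' b' c') * P a2 b2 c2 = P a2 b2 c2 * (P a b c + P a' b' c') := by
      rw [add_mul, mul_add, horth _ _ _ _ _ _ h13, horth _ _ _ _ _ _ h23,
        horth a2 b2 c2 a b c (by linarith), horth a2 b2 c2 a' b' c' (by linarith)]
    rw [← hsum, hv.add _ _ ((hsa _ _ _).add (hsa _ _ _)) (hsa _ _ _) c3,
      hv.add _ _ (hsa _ _ _) (hsa _ _ _) c12, z1, z2] at h1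
    simpa using h1

open ContinuousLinearMap in
lemma no_val_infinite {H : Type*} [NormedAddCommGroup H] [InnerProductSpace ℂ H]
    [CompleteSpace H] (hinf : ¬ FiniteDimensional ℂ H)
    {v : (H →L[ℂ] H) → ℂ} (hv : IsVal v) : False := by
  classical
  obtain ⟨s, b, -⟩ := exists_hilbertBasis ℂ H
  have hs : Infinite s := by
    by_contra h
    rw [not_infinite_iff_finite] at h
    haveI := Fintype.ofFinite s
    exact hinf (b.toOrthonormalBasis.toBasis.finiteDimensional_of_finite)
  obtain ⟨t⟩ : Nonempty (Fin 3 × s ≃ s) := by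
    rw [← Cardinal.eq, Cardinal.mk_prod]
    simp only [Cardinal.lift_uzero, Cardinal.mk_fin, Cardinal.lift_natCast]
    exact Cardinal.mul_eq_right (Cardinal.aleph0_le_mk s)
      ((Cardinal.natCast_lt_aleph0 (n := 3)).le.trans (Cardinal.aleph0_le_mk s)) (by norm_num)
  have ho : ∀ i : Fin 3, Orthonormal ℂ (fun k => b (t (i, k))) := fun i =>
    b.orthonormal.comp (fun k => t (i, k)) (fun k l h => by simpa using h)
  let e : Fin 3 → (H →L[ℂ] H) := fun i =>
    (ho i).orthogonalFamily.linearIsometry.toContinuousLinearMap ∘L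
      (b.repr.toContinuousLinearEquiv : H →L[ℂ] _)
  have heb : ∀ i k, e i (b k) = b (t (i, k)) := by
    intro i k
    simp [e, b.repr_self, OrthogonalFamily.linearIsometry_apply_single]
  clear_value e
  have hext : ∀ f g : H →L[ℂ] H, (∀ k, f (b k) = g (b k)) → f = g := by
    intro f g h
    refine ContinuousLinearMap.ext_on (s := Set.range b) ?_ ?_
    · rw [dense_iff_closure_eq, ← Submodule.topologicalClosure_coe, b.dense_span]; rfl
    · rintro _ ⟨k, rfl⟩; exact h k
  have hon := orthonormal_iff_ite.1 b.orthonormal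
  have hinner : ∀ x y : H, (∀ k, inner ℂ (b k) x = inner ℂ (b k) y) → x = y := by
    intro x y h
    apply b.repr.injective
    ext k
    rw [b.repr_apply_apply, b.repr_apply_apply, h k]
  have he : ∀ i j, adjoint (e i) ∘L e j = if i = j then ContinuousLinearMap.id ℂ H else 0 := by
    intro i j
    apply hext
    intro k
    apply hinner
    intro l
    rw [comp_apply, adjoint_inner_right, heb, heb, hon]
    split_ifs with h1 h2 h2
    · have := t.injective h1
      simp only [Prod.mk.injEq] at this
      rw [this.2]
      exact ((hon k k).trans (if_pos rfl)).symm
    · have := t.injective h1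
      simp only [Prod.mk.injEq] at this
      exact absurd this.1 h2
    · have : l ≠ k := by
        rintro rfl
        exact h1 (by rw [h2])
      simp [hon, this]
    · simp
  refine no_val_of_frame hv e he ?_
  have hE : e 0 ∘L adjoint (e 0) + e 1 ∘L adjoint (e 1) + e 2 ∘L adjoint (e 2) = 1 := by
    have hE' : ∀ j, (e 0 ∘L adjoint (e 0) + e 1 ∘L adjoint (e 1) + e 2 ∘L adjoint (e 2)) ∘L e j
        = e j := by
      intro j
      rw [add_comp, add_comp, comp_assoc, comp_assoc, comp_assoc, he, he, he]
      fin_cases j <;> simp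
    apply hext
    intro k
    obtain ⟨⟨j, l⟩, rfl⟩ := t.surjective k
    rw [← heb, ← comp_apply, hE']
    rfl
  rw [hE, hv.one]

open ContinuousLinearMap in
lemma no_val_finite {H : Type*} [NormedAddCommGroup H] [InnerProductSpace ℂ H]
    [CompleteSpace H] [FiniteDimensional ℂ H] (hdim : 3 ≤ Module.finrank ℂ H)
    {v : (H →L[ℂ] H) → ℂ} (hv : IsVal v) : False := by
  classical
  let b := stdOrthonormalBasis ℂ H
  let g : Fin (Module.finrank ℂ H) → (ℂ →L[ℂ] H) := fun i => toSpanSingleton ℂ (b i)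
  have hg : ∀ i j, adjoint (g i) ∘L g j = if i = j then ContinuousLinearMap.id ℂ ℂ else 0 := by
    intro i j
    ext
    have h : inner ℂ (1 : ℂ) ((adjoint (g i) ∘L g j) 1) = if i = j then 1 else 0 := by
      rw [comp_apply, adjoint_inner_right]
      simpa [g] using orthonormal_iff_ite.1 b.orthonormal i j
    have h' : (adjoint (g i) ∘L g j) 1 = if i = j then 1 else 0 := by
      rw [← h]; simp
    rw [h']
    split_ifs <;> simp
  let q : Fin (Module.finrank ℂ H) → (H →L[ℂ] H) := fun i => g i ∘L adjoint (g i)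
  have hq : ∀ i, IsSelfAdjoint (q i) := by
    intro i
    rw [isSelfAdjoint_iff, star_eq_adjoint]
    simp [q, adjoint_comp]
  have hqq : ∀ i j, q i * q j = if i = j then q i else 0 := by
    intro i j
    have : q i * q j = g i ∘L (adjoint (g i) ∘L g j) ∘L adjoint (g j) := rfl
    rw [this, hg]
    split_ifs with h
    · subst h; rfl
    · simp
  have hqc : ∀ i j, q i * q j = q j * q i := by
    intro i j
    by_cases h : i = j
    · rw [h]
    · rw [hqq, hqq, if_neg h, if_neg (Ne.symm h)]
  have hsum : ∑ i, q i = 1 := by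
    apply ContinuousLinearMap.coe_injective
    apply b.toBasis.ext
    intro j
    have h1 : ∀ i, q i (b j) = if i = j then b j else 0 := by
      intro i
      have h2 : b j = g j 1 := by simp [g]
      have h3 : q i (g j 1) = g i ((adjoint (g i) ∘L g j) 1) := rfl
      rw [h2, h3, hg]
      split_ifs with h
      · subst h; simp
      · simp
    simp [sum_apply, h1]
  have hv1 := hv.sum Finset.univ q hq hqc
  rw [hsum, hv.one] at hv1
  obtain ⟨i, hi⟩ : ∃ i, v (q i) = 1 := by
    by_contra! hne
    have : ∀ i, v (q i) = 0 := fun i =>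
      (hv.zero_or_one (hq i) (by rw [hqq, if_pos rfl])).resolve_right (hne i)
    simp [this] at hv1
  have hother : ∀ j, j ≠ i → v (q j) = 0 := by
    intro j hj
    have := hv.orth (hq j) (hq i) (by rw [hqq, if_neg hj]) (by rw [hqq, if_neg hj.symm])
    rwa [hi, mul_one] at this
  obtain ⟨j, k, hji, hki, hjk⟩ : ∃ j k, j ≠ i ∧ k ≠ i ∧ j ≠ k := by
    have hc : 1 < (Finset.univ.erase i).card := by
      rw [Finset.card_erase_of_mem (Finset.mem_univ _), Finset.card_univ, Fintype.card_fin]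
      omega
    obtain ⟨j, hj, k, hk, hjk⟩ := Finset.one_lt_card.1 hc
    exact ⟨j, k, Finset.ne_of_mem_erase hj, Finset.ne_of_mem_erase hk, hjk⟩
  refine no_val_of_frame hv ![g i, g j, g k] ?_ ?_
  · intro x y
    fin_cases x <;> fin_cases y <;>
      simp [hg, hji, hki, hjk, hji.symm, hki.symm, hjk.symm]
  · show v (q i + q j + q k) = 1
    rw [hv.add _ _ ((hq i).add (hq j)) (hq k) (by rw [add_mul, mul_add, hqc i k, hqc j k]),
      hv.add _ _ (hq i) (hq j) (hqc i j), hi, hother j hji, hother k hki]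
    simp

end KSaux

/-- Topological Kochen–Specker theorem: for `A = B(H)` with `dim H ≥ 3`, the projection
`π : Σ → 𝒞(A)` admits no continuous cross-section. -/
theorem kochen_specker_topological (H : Type*) [NormedAddCommGroup H]
    [InnerProductSpace ℂ H] [CompleteSpace H] (hdim : 3 ≤ Module.rank ℂ H) :
    ¬ ∃ σ : CommCStarSubalg (H →L[ℂ] H) → GelfandSpec (H →L[ℂ] H),
        Continuous σ ∧ ∀ C : CommCStarSubalg (H →L[ℂ] H), (σ C).1 = C := by
  rintro ⟨σ, hc, hσ⟩
  obtain ⟨v, hv⟩ := exists_val hc hσ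
  by_cases hfin : FiniteDimensional ℂ H
  · refine no_val_finite ?_ hv
    rw [← Module.finrank_eq_rank] at hdim
    exact_mod_cast hdim
  · exact no_val_infinite hfin hv
end

section
/- Fix C ∈ 𝒞(A) and let Σ_{↑C} = ∐_{D ∈ 𝒞(A), D ⊇ C} Σ(D), with the subspace topology inherited from Σ. Then the map sending c ∈ C to the function Σ_{↑C} → ℂ defined by λ ↦ λ(c) for λ ∈ Σ(D), D ⊇ C, is a unital ⋆-algebra isomorphism from C onto the algebra C(Σ_{↑C}, ℂ) of all continuous complex-valued functions on Σ_{↑C}. -/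
open WeakDual WeakDual.CharacterSpace

variable (A : Type*) [NormedRing A] [StarRing A] [CStarRing A] [NormedAlgebra ℂ A]
  [StarModule ℂ A] [CompleteSpace A]

variable {A}

variable (A)

section helpers
variable {A}

noncomputable abbrev commNR (C : CommCStarSubalg A) : CommCStarAlgebra C.1 :=
  haveI : CompleteSpace C.1 := C.2.1.completeSpace_coe
  { (inferInstance : NormedRing C.1), (inferInstance : StarRing C.1),
    (inferInstance : NormedAlgebra ℂ C.1), (inferInstance : CompleteSpace C.1),
    (inferInstance : StarModule ℂ C.1) with
    norm_mul_self_le := fun x => (CStarRing.norm_star_mul_self (x := (x : A))).symm.le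
    mul_comm := fun a b => Subtype.ext (C.2.2 a a.2 b b.2) }

theorem gelfand_bij (C : CommCStarSubalg A) :
    ∃ e : C.1 ≃⋆ₐ[ℂ] C(characterSpace ℂ C.1, ℂ), ∀ c φ, e c φ = φ c := by
  letI := commNR C
  exact ⟨gelfandStarTransform C.1, fun c φ => rfl⟩

theorem exists_restrict {C D : CommCStarSubalg A} (h : C ≤ D) :
    ∃ r : C(characterSpace ℂ D.1, characterSpace ℂ C.1),
      ∀ ψ, RestrictsTo h ψ (r ψ) := by
  haveI : CompleteSpace C.1 := C.2.1.completeSpace_coe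
  haveI : CompleteSpace D.1 := D.2.1.completeSpace_coe
  exact ⟨compContinuousMap (StarSubalgebra.inclusion h), fun ψ a => rfl⟩

theorem restrict_unique {C D : CommCStarSubalg A} (h : C ≤ D) {ψ : characterSpace ℂ D.1}
    {φ φ' : characterSpace ℂ C.1} (h1 : RestrictsTo h ψ φ) (h2 : RestrictsTo h ψ φ') :
    φ = φ' :=
  WeakDual.CharacterSpace.ext fun a => (h1 a).symm.trans (h2 a)

set_option maxHeartbeats 2000000 in
theorem exists_retract (C : CommCStarSubalg A) :
    ∃ r : C({x : GelfandSpec A // C ≤ x.1}, characterSpace ℂ C.1),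
      ∀ x, RestrictsTo x.2 x.1.2 (r x) := by
  choose r hr using fun x : {D : CommCStarSubalg A // C ≤ D} => exists_restrict x.2
  refine ⟨⟨fun x => r ⟨x.1.1, x.2⟩ x.1.2, ?_⟩, fun x => hr ⟨x.1.1, x.2⟩ x.1.2⟩
  refine ⟨fun V hV => ?_⟩
  let U : Set (GelfandSpec A) := {x | ∃ h : C ≤ x.1, r ⟨x.1, h⟩ x.2 ∈ V}
  have hU : IsGoodOpen A U := by
    constructor
    · intro D
      by_cases h : C ≤ D
      · have : {φ : characterSpace ℂ D.1 | (⟨D, φ⟩ : GelfandSpec A) ∈ U}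
            = r ⟨D, h⟩ ⁻¹' V := by
          ext φ; exact ⟨fun ⟨_, h'⟩ => h', fun h' => ⟨h, h'⟩⟩
        rw [this]
        exact hV.preimage (r ⟨D, h⟩).continuous
      · have : {φ : characterSpace ℂ D.1 | (⟨D, φ⟩ : GelfandSpec A) ∈ U} = ∅ := by
          ext φ; exact ⟨fun ⟨h', _⟩ => h h', fun h' => h'.elim⟩
        rw [this]
        exact isOpen_empty
    · rintro D E hDE φ ψ hr' ⟨h, hm⟩
      refine ⟨h.trans hDE, ?_⟩
      have : r ⟨E, h.trans hDE⟩ ψ = r ⟨D, h⟩ φ := by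
        refine restrict_unique (h.trans hDE) (hr ⟨E, h.trans hDE⟩ ψ) fun a => ?_
        exact (hr' ⟨a.1, h a.2⟩).trans (hr ⟨D, h⟩ φ a)
      change r ⟨E, h.trans hDE⟩ ψ ∈ V
      rw [this]
      exact hm
  refine isOpen_induced_iff.2 ⟨U, hU, Set.ext fun x => ?_⟩
  exact ⟨fun ⟨_, h'⟩ => h', fun h' => ⟨x.2, h'⟩⟩

theorem continuous_incl (C : CommCStarSubalg A) :
    Continuous (fun φ : characterSpace ℂ C.1 =>
      (⟨⟨C, φ⟩, le_rfl⟩ : {x : GelfandSpec A // C ≤ x.1})) := by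
  refine Continuous.subtype_mk ⟨fun U hU => ?_⟩ _
  exact hU.1 C

theorem eq_of_restrictsTo (C : CommCStarSubalg A)
    (f : C({x : GelfandSpec A // C ≤ x.1}, ℂ)) (x : {x : GelfandSpec A // C ≤ x.1})
    (φ : characterSpace ℂ C.1) (h : RestrictsTo x.2 x.1.2 φ) :
    f ⟨⟨C, φ⟩, le_rfl⟩ = f x := by
  refine (Specializes.map (specializes_iff_forall_open.2 ?_) f.continuous).eq.symm
  rintro s ⟨U, hU, rfl⟩ hs
  exact hU.2 C x.1.1 x.2 φ x.1.2 h hs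

end helpers

/-- For fixed `C ∈ 𝒞(A)`, the map sending `c ∈ C` to the evaluation function
`λ ↦ λ(c)` on `Σ_{↑C} = ∐_{D ⊇ C} Σ(D)` (with the subspace topology inherited from `Σ`)
is a unital ⋆-algebra isomorphism of `C` onto `C(Σ_{↑C}, ℂ)`. -/
theorem starAlgEquiv_continuousFunctions_on_upSet (C : CommCStarSubalg A) :
    ∃ e : C.1 ≃⋆ₐ[ℂ] ContinuousMap {x : GelfandSpec A // C ≤ x.1} ℂ,
      ∀ (c : C.1) (x : {x : GelfandSpec A // C ≤ x.1}),
        e c x = x.1.2 (⟨(c : A), x.2 c.2⟩ : x.1.1.1) := by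
  obtain ⟨g, hg⟩ := gelfand_bij C
  obtain ⟨r, hr⟩ := exists_retract C
  have hri : ∀ φ, r ⟨⟨C, φ⟩, le_rfl⟩ = φ := fun φ =>
    restrict_unique le_rfl (hr ⟨⟨C, φ⟩, le_rfl⟩) fun _ => rfl
  refine ⟨StarAlgEquiv.ofBijective
    ((ContinuousMap.compStarAlgHom' ℂ ℂ r).comp (g : C.1 →⋆ₐ[ℂ] _)) ⟨?_, ?_⟩, ?_⟩
  · intro a b hab
    apply g.injective
    ext φ
    have := DFunLike.congr_fun hab ⟨⟨C, φ⟩, le_rfl⟩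
    change g a (r _) = g b (r _) at this
    rwa [hri] at this
  · intro f
    obtain ⟨c, hc⟩ := g.surjective (f.comp ⟨_, continuous_incl C⟩)
    refine ⟨c, ?_⟩
    ext x
    refine (DFunLike.congr_fun hc (r x)).trans ?_
    exact eq_of_restrictsTo C f x (r x) (hr x)
  · intro c x
    change g c (r x) = _
    rw [hg]
    exact (hr x c).symm
end
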